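/- Let I ⊂ S be a monomial ideal minimally generated by m monomials. If slength(I) = m ≤ 3, then I has linear quotients. -/

import Mathlib

open MvPolynomial

/-- The set of exponent vectors of the monomials in the Stanley space `x^u · K[Z]`. -/
def stanleySet {σ : Type} (u : σ →₀ ℕ) (Z : Set σ) : Set (σ →₀ ℕ) :=
  {w | ∃ v : σ →₀ ℕ, ↑v.support ⊆ Z ∧ w = u + v}

/-- A Stanley decomposition (partition into Stanley spaces) of a set `P` of
exponent vectors of monomials.  By the standard correspondence, Stanley
decompositions of a multigraded `K`-vector subquotient of `S` spanned by the
monomials with exponents in `P` correspond exactly to such partitions. -/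
structure StanleyPartition {σ : Type} (P : Set (σ →₀ ℕ)) where
  r : ℕ
  base : Fin r → σ →₀ ℕ
  vars : Fin r → Set σ
  cover : P = ⋃ i, stanleySet (base i) (vars i)
  disj : ∀ i j, i ≠ j → Disjoint (stanleySet (base i) (vars i)) (stanleySet (base j) (vars j))

/-- The Stanley length of `P`: the minimal length of a Stanley decomposition. -/
noncomputable def slength {σ : Type} (P : Set (σ →₀ ℕ)) : ℕ :=
  sInf {r | ∃ D : StanleyPartition P, D.r = r}

/-- The set of exponent vectors of the monomials belonging to an ideal. -/
def monSet {σ K : Type} [Field K] (I : Ideal (MvPolynomial σ K)) : Set (σ →₀ ℕ) :=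
  {d | (monomial d (1 : K) : MvPolynomial σ K) ∈ I}

/-- `I` is a monomial ideal. -/
def IsMonomialIdeal {σ K : Type} [Field K] (I : Ideal (MvPolynomial σ K)) : Prop :=
  ∃ A : Set (σ →₀ ℕ), I = Ideal.span ((fun d => (monomial d (1 : K) : MvPolynomial σ K)) '' A)

/-- Exponent vectors of the minimal monomial generators of `I`. -/
def minGens {σ K : Type} [Field K] (I : Ideal (MvPolynomial σ K)) : Set (σ →₀ ℕ) :=
  {d | d ∈ monSet I ∧ ∀ e ∈ monSet I, e ≤ d → e = d}

/-- `I` has linear quotients: there is an ordering `u_0, …, u_{m-1}` of its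
minimal monomial generators such that each colon ideal
`(u_0,…,u_{j-1}) : u_j` is generated by a subset of the variables. -/
def HasLinearQuotients {K : Type} [Field K] {n : ℕ}
    (I : Ideal (MvPolynomial (Fin n) K)) : Prop :=
  ∃ (m : ℕ) (u : Fin m → (Fin n →₀ ℕ)), Function.Injective u ∧
    Set.range u = minGens I ∧
    ∀ j : Fin m, 0 < j.val → ∃ V : Set (Fin n),
      Submodule.colon
        (Ideal.span ((fun i : Fin m => (monomial (u i) (1 : K) :
          MvPolynomial (Fin n) K)) '' {i | i < j}))
        (Ideal.span {(monomial (u j) (1 : K) : MvPolynomial (Fin n) K)}) =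
      Ideal.span ((fun k => (MvPolynomial.X k : MvPolynomial (Fin n) K)) '' V)

theorem mem_stanleySet_base {σ : Type} (u : σ →₀ ℕ) (Z : Set σ) : u ∈ stanleySet u Z :=
  ⟨0, by simp, by simp⟩

theorem add_mem_stanleySet_iff {σ : Type} (u v : σ →₀ ℕ) (Z : Set σ) :
    u + v ∈ stanleySet u Z ↔ ↑v.support ⊆ Z := by
  constructor
  · rintro ⟨w, hw, h⟩
    rwa [add_left_cancel h]
  · intro h
    exact ⟨v, h, rfl⟩

theorem le_of_mem_stanleySet {σ : Type} {u w : σ →₀ ℕ} {Z : Set σ} (h : w ∈ stanleySet u Z) :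
    u ≤ w := by
  obtain ⟨v, -, rfl⟩ := h
  exact le_self_add

/-- If a Stanley space based at `u` meets the principal ideal of `u'`, it contains the least
common multiple of `u` and `u'`. -/
theorem sup_mem_stanleySet {σ : Type} {u u' w : σ →₀ ℕ} {Z : Set σ} (hw : w ∈ stanleySet u Z)
    (h : u' ≤ w) : u ⊔ u' ∈ stanleySet u Z := by
  obtain ⟨v, hv, rfl⟩ := hw
  refine ⟨u' - u, fun k hk => hv ?_, ?_⟩
  · have := h k
    simp at hk this ⊢
    omega
  · ext k
    simp
    omega

theorem monSet_upward {σ K : Type} [Field K] {I : Ideal (MvPolynomial σ K)} {d e : σ →₀ ℕ}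
    (hd : d ∈ monSet I) (h : d ≤ e) : e ∈ monSet I := by
  obtain ⟨c, rfl⟩ := exists_add_of_le h
  have := I.mul_mem_right (monomial c (1 : K)) hd
  rwa [monomial_mul, one_mul] at this

namespace StanleyPartition

variable {σ : Type} {P : Set (σ →₀ ℕ)} (D : StanleyPartition P)

/-- The `i`-th Stanley space of the partition. -/
def space (i : Fin D.r) : Set (σ →₀ ℕ) := stanleySet (D.base i) (D.vars i)

theorem mem_iff {w : σ →₀ ℕ} : w ∈ P ↔ ∃ i, w ∈ D.space i := by
  conv_lhs => rw [D.cover]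
  simp [space]

theorem base_mem_space (i : Fin D.r) : D.base i ∈ D.space i := mem_stanleySet_base _ _

theorem base_mem (i : Fin D.r) : D.base i ∈ P := D.mem_iff.2 ⟨i, D.base_mem_space i⟩

theorem eq_of_mem {w : σ →₀ ℕ} {i j : Fin D.r} (hi : w ∈ D.space i) (hj : w ∈ D.space j) :
    i = j := by
  by_contra h
  exact Set.disjoint_left.1 (D.disj i j h) hi hj

theorem base_injective : Function.Injective D.base := by
  intro i j h
  refine D.eq_of_mem (w := D.base i) (D.base_mem_space i) ?_
  rw [h]
  exact D.base_mem_space j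

/-- The `j`-th Stanley space contains a multiple of the `i`-th base. -/
def Meets (i j : Fin D.r) : Prop := ∃ w ∈ D.space j, D.base i ≤ w

theorem Meets.eq {i j : Fin D.r} (hij : D.Meets i j) (hji : D.Meets j i) : i = j := by
  obtain ⟨w, hw, h⟩ := hij
  obtain ⟨w', hw', h'⟩ := hji
  have h₁ := sup_mem_stanleySet hw h
  have h₂ := sup_mem_stanleySet hw' h'
  rw [sup_comm] at h₂
  exact D.eq_of_mem h₂ h₁

/-- If `P` is closed under multiples, then one of the Stanley spaces meets every principal
ideal generated by a base. -/
theorem exists_forall_meets [Fintype σ] (hP : ∀ d ∈ P, ∀ e, d ≤ e → e ∈ P) (i₀ : Fin D.r) :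
    ∃ a, ∀ i, D.Meets i a := by
  let W : σ →₀ ℕ := ∑ i, D.base i + Finsupp.equivFunOnFinite.symm 1
  have hle : ∀ i, D.base i ≤ ∑ i, D.base i := fun i =>
    Finset.single_le_sum (f := D.base) (fun _ _ => zero_le) (Finset.mem_univ i)
  have hW : ∀ i, D.base i ≤ W := fun i => (hle i).trans le_self_add
  obtain ⟨a, ha⟩ := D.mem_iff.1 (hP _ (D.base_mem i₀) W (hW i₀))
  exact ⟨a, fun i => ⟨W, ha, hW i⟩⟩

end StanleyPartition

/-- An antisymmetric relation on at most three points, one of which is only related to itself, is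
contained in the reverse of a linear order. -/
theorem exists_perm_forall_lt_not {m : ℕ} (hm : m ≤ 3) (R : Fin m → Fin m → Prop)
    (hR : ∀ i j, R i j → R j i → i = j) (a : Fin m) (ha : ∀ j, R a j → a = j) :
    ∃ e : Equiv.Perm (Fin m), ∀ i j, i < j → ¬ R (e i) (e j) := by
  have key : ∀ (h0 : 0 < m) (e : Equiv.Perm (Fin m)), e ⟨0, h0⟩ = a →
      ∀ j : Fin m, 0 < j.val → ¬ R (e ⟨0, h0⟩) (e j) := by
    intro h0 e he j hj h
    rw [he] at h
    have := ha _ h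
    rw [← he] at this
    have := e.injective this
    subst this
    simp at hj
  have h0 : 0 < m := a.pos
  have hs : Equiv.swap (⟨0, h0⟩ : Fin m) a ⟨0, h0⟩ = a := Equiv.swap_apply_left _ _
  set s := Equiv.swap (⟨0, h0⟩ : Fin m) a
  by_cases h3 : m = 3
  · subst h3
    have main : ∀ e : Equiv.Perm (Fin 3), e 0 = a → ¬ R (e 1) (e 2) →
        ∀ i j, i < j → ¬ R (e i) (e j) := by
      intro e he h12 i j hij
      have := key h0 e he j (by omega)
      by_cases hi : i = 0
      · subst hi; exact this
      · have h1 : i = 1 := by omega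
        have h2 : j = 2 := by omega
        subst h1 h2
        exact h12
    by_cases h12 : R (s 1) (s 2)
    · refine ⟨(Equiv.swap 1 2).trans s, main _ ?_ ?_⟩
      · have h0' : Equiv.swap (1 : Fin 3) 2 0 = 0 := by decide
        rw [Equiv.trans_apply, h0']
        exact hs
      · simp only [Equiv.trans_apply, Equiv.swap_apply_left, Equiv.swap_apply_right]
        intro h
        have := s.injective (hR _ _ h12 h)
        exact absurd this (by decide)
    · exact ⟨s, main s hs h12⟩
  · refine ⟨s, fun i j hij => ?_⟩
    have hi : i = ⟨0, h0⟩ := by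
      ext
      have := j.isLt
      have : i.val < j.val := hij
      simp
      omega
    subst hi
    exact key h0 s hs j hij

theorem colon_span_monomial_eq_span_X {K ι σ : Type} [Field K] (u : ι → σ →₀ ℕ) (A : Set ι)
    (b : σ →₀ ℕ) (V : Set σ)
    (h : ∀ v : σ →₀ ℕ, (∃ i ∈ A, u i ≤ b + v) ↔ ∃ k ∈ V, v k ≠ 0) :
    Submodule.colon
        (Ideal.span ((fun i => (monomial (u i) (1 : K) : MvPolynomial σ K)) '' A))
        (Ideal.span {(monomial b (1 : K) : MvPolynomial σ K)}) =
      Ideal.span ((fun k => (X k : MvPolynomial σ K)) '' V) := by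
  ext f
  have himg : (fun i => (monomial (u i) (1 : K) : MvPolynomial σ K)) '' A =
      (fun d => monomial d (1 : K)) '' (u '' A) := by
    rw [Set.image_image]
  rw [mem_ideal_span_X_image, himg, Ideal.mem_colon_span_singleton,
    mem_ideal_span_monomial_image]
  simp only [Set.exists_mem_image, ← h]
  constructor
  · intro H v hv
    refine H (b + v) ?_
    rw [mem_support_iff, add_comm, coeff_mul_monomial, mul_one]
    exact mem_support_iff.1 hv
  · intro H w hw
    rw [mem_support_iff, coeff_mul_monomial'] at hw
    split_ifs at hw with hbw
    · obtain ⟨v, rfl⟩ := exists_add_of_le hbw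
      refine H v ?_
      simpa using hw
    · exact absurd rfl hw

/-- If `I` is a monomial ideal minimally generated by `m`
monomials and `slength(I) = m ≤ 3`, then `I` has linear quotients. -/
theorem stmt_19 {K : Type} [Field K] {n m : ℕ} (I : Ideal (MvPolynomial (Fin n) K))
    (hmon : IsMonomialIdeal I) (hne : I ≠ ⊥)
    (hfin : (minGens I).Finite) (hcard : (minGens I).ncard = m)
    (hsl : slength (monSet I) = m) (hm : m ≤ 3) :
    HasLinearQuotients I := by
  rcases Nat.eq_zero_or_pos m with rfl | hpos
  · refine ⟨0, Fin.elim0, fun i => i.elim0, ?_, fun j => j.elim0⟩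
    rw [(Set.ncard_eq_zero hfin).1 hcard, Set.range_eq_empty]
  obtain ⟨D, rfl⟩ : ∃ D : StanleyPartition (monSet I), D.r = m := by
    have := Nat.sInf_mem (Nat.nonempty_of_pos_sInf (hpos.trans_eq hsl.symm))
    rwa [← slength, hsl] at this
  have hrange : Set.range D.base = minGens I := by
    symm
    refine Set.eq_of_subset_of_ncard_le ?_ ?_ (Set.finite_range _)
    · intro d hd
      obtain ⟨i, hi⟩ := D.mem_iff.1 hd.1
      exact ⟨i, hd.2 _ (D.base_mem i) (le_of_mem_stanleySet hi)⟩
    · rw [hcard, ← Set.image_univ, Set.ncard_image_of_injective _ D.base_injective]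
      simp
  obtain ⟨a, ha⟩ := D.exists_forall_meets (fun d hd e h => monSet_upward hd h) ⟨0, hpos⟩
  obtain ⟨e, he⟩ := exists_perm_forall_lt_not hm D.Meets (fun i j => StanleyPartition.Meets.eq D) a
    (fun j h => StanleyPartition.Meets.eq D h (ha j))
  refine ⟨D.r, D.base ∘ e, D.base_injective.comp e.injective, ?_, fun j _ =>
    ⟨(D.vars (e j))ᶜ, colon_span_monomial_eq_span_X _ _ _ _ fun v => ?_⟩⟩
  · rw [e.surjective.range_comp, hrange]
  have hV : (∃ k ∈ (D.vars (e j))ᶜ, v k ≠ 0) ↔ D.base (e j) + v ∉ D.space (e j) := by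
    rw [StanleyPartition.space, add_mem_stanleySet_iff, Set.not_subset]
    simp [and_comm]
  rw [hV]
  constructor
  · rintro ⟨i, hi, hle⟩ hmem
    exact he i j hi ⟨_, hmem, hle⟩
  · intro hmem
    obtain ⟨i, hi⟩ := D.mem_iff.1 (monSet_upward (D.base_mem (e j)) le_self_add :
      D.base (e j) + v ∈ monSet I)
    obtain ⟨i, rfl⟩ := e.surjective i
    refine ⟨i, ?_, le_of_mem_stanleySet hi⟩
    rcases lt_trichotomy i j with h | rfl | h
    · exact h
    · exact absurd hi hmem
    · exact absurd ⟨_, hi, le_self_add⟩ (he j i h)
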